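/- For every integer n >= 1, the n-th power of the matrix C1 is given explicitly by C1^n = (x1^n + y1 y1' r_{n-1} , y1 q_{n-1} ; y1' q_{n-1} , (x1')^n - y1 y1' s_{n-1}), where q_m = sum_{i=0}^{m} x1^i (x1')^{m-i}, r_m = sum_{i=0}^{m-1} (m-i) x1^{m-1-i} (x1')^i, and s_m = sum_{i=0}^{m-1} (m-i) (x1')^{m-1-i} x1^i are elements of R (with r_0 = s_0 = 0 and q_0 = 1). -/

import Mathlib

open scoped TensorProduct

noncomputable section

/-- The free supercommutative algebra on four even variables `x1, x2, x1', x2'` and four odd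
variables `y1, y2, y1', y2'`: the tensor product of a polynomial ring in four variables with
the exterior algebra on a four-dimensional space. -/
abbrev FreeSuperComm (K : Type*) [Field K] :=
  (MvPolynomial (Fin 4) K) ⊗[K] (ExteriorAlgebra K (Fin 4 → K))

/-- The even generators: `xg K 0 = x1`, `xg K 1 = x1'`, `xg K 2 = x2`, `xg K 3 = x2'`. -/
def xg (K : Type*) [Field K] (i : Fin 4) : FreeSuperComm K :=
  (MvPolynomial.X i) ⊗ₜ[K] 1

/-- The odd generators: `yg K 0 = y1`, `yg K 1 = y1'`, `yg K 2 = y2`, `yg K 3 = y2'`. -/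
def yg (K : Type*) [Field K] (i : Fin 4) : FreeSuperComm K :=
  1 ⊗ₜ[K] (ExteriorAlgebra.ι K (Pi.single i 1))

/-- The generic matrix `C1 = (x1, y1; y1', x1')`. -/
def genC₁ (K : Type*) [Field K] : Matrix (Fin 2) (Fin 2) (FreeSuperComm K) :=
  !![xg K 0, yg K 0; yg K 1, xg K 1]

/-- The generic matrix `C2 = (x2, y2; y2', x2')`. -/
def genC₂ (K : Type*) [Field K] : Matrix (Fin 2) (Fin 2) (FreeSuperComm K) :=
  !![xg K 2, yg K 2; yg K 3, xg K 3]

/-- `F = K[C1, C2]`, the unital subalgebra generated by the two generic matrices. -/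
def Falg (K : Type*) [Field K] : Subalgebra K (Matrix (Fin 2) (Fin 2) (FreeSuperComm K)) :=
  Algebra.adjoin K {genC₁ K, genC₂ K}

/-- `q m = ∑_{i=0}^{m} x1^i (x1')^(m-i)`; in particular `q 0 = 1`. -/
def qpoly (K : Type*) [Field K] (m : ℕ) : FreeSuperComm K :=
  ∑ i ∈ Finset.range (m + 1), (xg K 0) ^ i * (xg K 1) ^ (m - i)

/-- `r m = ∑_{i=0}^{m-1} (m-i) x1^(m-1-i) (x1')^i`; in particular `r 0 = 0`. -/
def rpoly (K : Type*) [Field K] (m : ℕ) : FreeSuperComm K :=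
  ∑ i ∈ Finset.range m, (m - i) • ((xg K 0) ^ (m - 1 - i) * (xg K 1) ^ i)

/-- `s m = ∑_{i=0}^{m-1} (m-i) (x1')^(m-1-i) x1^i`; in particular `s 0 = 0`. -/
def spoly (K : Type*) [Field K] (m : ℕ) : FreeSuperComm K :=
  ∑ i ∈ Finset.range m, (m - i) • ((xg K 1) ^ (m - 1 - i) * (xg K 0) ^ i)

lemma xg_comm_aux (K : Type*) [Field K] (i : Fin 4) (a : FreeSuperComm K) :
    xg K i * a = a * xg K i := by
  induction a using TensorProduct.induction_on with
  | zero => simp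
  | tmul p e =>
    simp only [xg, Algebra.TensorProduct.tmul_mul_tmul, one_mul, mul_one, mul_comm]
  | add a b ha hb => rw [mul_add, add_mul, ha, hb]

lemma yg_sq_aux (K : Type*) [Field K] (i : Fin 4) : yg K i * yg K i = 0 := by
  simp [yg, Algebra.TensorProduct.tmul_mul_tmul]

lemma yg_anti_aux (K : Type*) [Field K] (i j : Fin 4) :
    yg K i * yg K j + yg K j * yg K i = 0 := by
  simp only [yg, Algebra.TensorProduct.tmul_mul_tmul, ← TensorProduct.tmul_add, one_mul,
    ExteriorAlgebra.ι_add_mul_swap, TensorProduct.tmul_zero]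

lemma anti_zero_aux {A : Type*} [Ring A] {a b : A} (h : b * a + a * b = 0) (hb : b * b = 0)
    (c : A) : b * (a * b * c) = 0 := by
  rw [← mul_assoc, ← mul_assoc, eq_neg_of_add_eq_zero_left h, neg_mul, mul_assoc a, hb,
    mul_zero, neg_zero, zero_mul]

lemma anti_sub_aux {A : Type*} [Ring A] {a b : A} (h : b * a + a * b = 0) (q s u : A) :
    b * (a * q) + (u - s) = u - (a * b * (q) + s) := by
  rw [← mul_assoc, eq_neg_of_add_eq_zero_left h, neg_mul]
  abel

lemma rsum_aux {A : Type*} [Ring A] (a b : A) (m : ℕ) :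
    ∑ i ∈ Finset.range (m + 1), (m + 1 - i) • (a ^ (m + 1 - 1 - i) * b ^ i) =
      a * (∑ i ∈ Finset.range m, (m - i) • (a ^ (m - 1 - i) * b ^ i)) +
        ∑ i ∈ Finset.range (m + 1), a ^ (m - i) * b ^ i := by
  have h : a * (∑ i ∈ Finset.range m, (m - i) • (a ^ (m - 1 - i) * b ^ i)) =
      ∑ i ∈ Finset.range (m + 1), (m - i) • (a ^ (m - i) * b ^ i) := by
    rw [Finset.sum_range_succ, Finset.mul_sum]
    simp only [Nat.sub_self, zero_smul, add_zero]
    refine Finset.sum_congr rfl fun i hi => ?_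
    have hi := Finset.mem_range.1 hi
    rw [mul_smul_comm, ← mul_assoc, ← pow_succ']
    congr 3
    omega
  rw [h, ← Finset.sum_add_distrib]
  refine Finset.sum_congr rfl fun i hi => ?_
  have hi := Finset.mem_range.1 hi
  rw [← succ_nsmul]
  congr 1
  omega

lemma rpoly_succ_aux (K : Type*) [Field K] (m : ℕ) :
    rpoly K (m + 1) = xg K 0 * rpoly K m + qpoly K m := by
  unfold rpoly qpoly
  rw [rsum_aux]
  congr 1
  rw [← Finset.sum_range_reflect]
  refine Finset.sum_congr rfl fun i hi => ?_
  have hi := Finset.mem_range.1 hi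
  congr 2 <;> omega

lemma spoly_succ_aux (K : Type*) [Field K] (m : ℕ) :
    spoly K (m + 1) = xg K 1 * spoly K m + qpoly K m := by
  unfold spoly qpoly
  rw [rsum_aux]
  congr 1
  refine Finset.sum_congr rfl fun i hi => ?_
  exact ((show Commute (xg K 1) (xg K 0) from xg_comm_aux K 1 _).pow_pow _ _).eq

lemma qpoly_succ_aux (K : Type*) [Field K] (m : ℕ) :
    qpoly K (m + 1) = xg K 0 * qpoly K m + xg K 1 ^ (m + 1) := by
  unfold qpoly
  rw [Finset.sum_range_succ', Finset.mul_sum]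
  simp [pow_succ', mul_assoc]

lemma qpoly_succ_aux2 (K : Type*) [Field K] (m : ℕ) :
    qpoly K (m + 1) = xg K 0 ^ (m + 1) + xg K 1 * qpoly K m := by
  unfold qpoly
  rw [Finset.sum_range_succ, Finset.mul_sum, add_comm]
  simp only [Nat.sub_self, pow_zero, mul_one]
  congr 1
  refine Finset.sum_congr rfl fun i hi => ?_
  have hi := Finset.mem_range.1 hi
  rw [xg_comm_aux K 1, mul_assoc, ← pow_succ]
  congr 2
  omega

lemma main_aux (K : Type*) [Field K] (m : ℕ) :
    (genC₁ K) ^ (m + 1) =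
      !![(xg K 0) ^ (m + 1) + yg K 0 * yg K 1 * rpoly K m, yg K 0 * qpoly K m;
         yg K 1 * qpoly K m, (xg K 1) ^ (m + 1) - yg K 0 * yg K 1 * spoly K m] := by
  induction m with
  | zero => simp [genC₁, rpoly, spoly, qpoly]
  | succ m ih =>
    rw [pow_succ', ih, genC₁, Matrix.mul_fin_two]
    have h1 : yg K 0 * (yg K 0 * yg K 1 * spoly K m) = 0 := by
      rw [← mul_assoc, ← mul_assoc, yg_sq_aux, zero_mul, zero_mul]
    have h2 : yg K 1 * (yg K 0 * yg K 1 * rpoly K m) = 0 := 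
      anti_zero_aux (yg_anti_aux K 1 0) (yg_sq_aux K 1) _
    have hx : ∀ i (a b : FreeSuperComm K), xg K i * (a * b) = a * (xg K i * b) := by
      intro i a b
      rw [← mul_assoc, xg_comm_aux, mul_assoc]
    congr 1
    ext i j
    fin_cases i <;> fin_cases j
    · simp only [rpoly_succ_aux, mul_add, hx 0 (yg K 0 * yg K 1), ← mul_assoc (yg K 0) (yg K 1)]
      simp [pow_succ' _ (m + 1), add_assoc]
    · simp [qpoly_succ_aux K m, mul_add, mul_sub, h1, hx 0 (yg K 0)]
    · simp [qpoly_succ_aux2 K m, mul_add, h2, hx 1 (yg K 1)]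
    · have h3 := anti_sub_aux (yg_anti_aux K 1 0) (qpoly K m)
        (xg K 1 * (yg K 0 * yg K 1 * spoly K m)) (xg K 1 * xg K 1 ^ (m + 1))
      rw [← mul_sub, add_comm (yg K 0 * yg K 1 * qpoly K m), hx 1 (yg K 0 * yg K 1), ← mul_add,
        ← spoly_succ_aux, ← pow_succ'] at h3
      exact h3

/- STATEMENT 18: for every n ≥ 1,
`C1^n = (x1^n + y1 y1' r_{n-1} , y1 q_{n-1} ; y1' q_{n-1} , (x1')^n - y1 y1' s_{n-1})`. -/
theorem stmt18 (K : Type*) [Field K] [CharZero K] (n : ℕ) (hn : 1 ≤ n) :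
    (genC₁ K) ^ n =
      !![(xg K 0) ^ n + yg K 0 * yg K 1 * rpoly K (n - 1), yg K 0 * qpoly K (n - 1);
         yg K 1 * qpoly K (n - 1), (xg K 1) ^ n - yg K 0 * yg K 1 * spoly K (n - 1)] := by
  obtain ⟨m, rfl⟩ : ∃ m, n = m + 1 := ⟨n - 1, by omega⟩
  exact main_aux K m
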